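/- arXiv:1806.05552 — 3 statements merged into one kernel-verified Lean document; each statement's English description precedes it below -/
import Mathlib

section
/- Let S be a locally noetherian scheme, U an open subscheme of S, A a scheme over U, and N a Néron model of A over S. Let s be a point of S, let S̃ = Spec(𝒪_{S,s}) be the spectrum of the local ring of S at s with its canonical morphism S̃ → S, and set Ũ = U ×_S S̃. Then N ×_S S̃, with its induced morphism to S̃ and the induced isomorphism over Ũ, is a Néron model of A ×_U Ũ over S̃. -/
open AlgebraicGeometry CategoryTheory CategoryTheory.Limits

/-- `IsNeronModel ι a p r` : the scheme `N`, with smooth separated finite-type structure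
morphism `p : N ⟶ S` and identification `r : N ×_S U ⟶ A` (an isomorphism over `U`),
is a Néron model over `S` of the `U`-scheme `A` (where `ι : U ⟶ S` is the open immersion
and `a : A ⟶ U` the structure morphism): every `U`-morphism `f : T ×_S U ⟶ A` from the
base change of a smooth `S`-scheme `T` extends uniquely to an `S`-morphism `g : T ⟶ N`.
The condition "the base change of `g` to `U` equals `f`" is expressed via the (unique)
morphism `φ : T ×_S U ⟶ N ×_S U` commuting with both projections. -/
def IsNeronModel {S U A N : Scheme} (ι : U ⟶ S) (a : A ⟶ U)
    (p : N ⟶ S) (r : pullback p ι ⟶ A) : Prop :=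
  IsSmooth p ∧ IsSeparated p ∧ LocallyOfFiniteType p ∧ QuasiCompact p ∧
  IsIso r ∧ r ≫ a = pullback.snd p ι ∧
  ∀ (T : Scheme) (t : T ⟶ S), IsSmooth t →
    ∀ f : pullback t ι ⟶ A, f ≫ a = pullback.snd t ι →
      ∃! g : T ⟶ N, g ≫ p = t ∧
        ∀ φ : pullback t ι ⟶ pullback p ι,
          φ ≫ pullback.fst p ι = pullback.fst t ι ≫ g →
          φ ≫ pullback.snd p ι = pullback.snd t ι →
          φ ≫ r = f

universe u

theorem exists_factor_fromSpecStalk {Z S : Scheme.{u}} (s : S) (y : Z ⟶ S)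
    (hy : ∀ V : S.Opens, IsAffineOpen V → s ∈ V → y ⁻¹ᵁ V = ⊤) :
    ∃ w : Z ⟶ Spec (S.presheaf.stalk s), w ≫ S.fromSpecStalk s = y := by
  obtain ⟨_, ⟨V, hV, rfl⟩, hsV, -⟩ :=
    S.isBasis_affineOpens.exists_subset_of_mem_open (Set.mem_univ s) isOpen_univ
  have hsV : s ∈ V := hsV
  have hV : IsAffineOpen V := hV
  have hle : (⊤ : Z.Opens) ≤ y ⁻¹ᵁ V := by rw [hy V hV hsV]
  let φ : Γ(S, V) ⟶ Γ(Z, ⊤) := y.appLE V ⊤ hle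
  let : Algebra Γ(S, V) (S.presheaf.stalk s) :=
    TopCat.Presheaf.algebra_section_stalk S.presheaf (⟨s, hsV⟩ : V)
  have hloc : IsLocalization.AtPrime (S.presheaf.stalk s) (hV.primeIdealOf ⟨s, hsV⟩).asIdeal :=
    hV.isLocalization_stalk ⟨s, hsV⟩
  have hunit : ∀ f : (hV.primeIdealOf ⟨s, hsV⟩).asIdeal.primeCompl, IsUnit (φ.hom f) := by
    rintro ⟨f, hf⟩
    have h1 : s ∈ S.basicOpen f := by
      rw [Scheme.mem_basicOpen S f s hsV]
      exact IsLocalization.map_units (S.presheaf.stalk s)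
        (⟨f, hf⟩ : (hV.primeIdealOf ⟨s, hsV⟩).asIdeal.primeCompl)
    have h2 := hy (S.basicOpen f) (hV.basicOpen f) h1
    have h3 : Z.basicOpen (φ.hom f) = ⊤ := by
      simp only [φ]
      rw [Scheme.basicOpen_appLE, h2, inf_top_eq]
    apply RingedSpace.isUnit_of_isUnit_germ Z.toRingedSpace
    intro x hx
    rw [← h3] at hx
    exact (Scheme.mem_basicOpen Z (U := ⊤) _ x trivial).1 hx
  let ψ : S.presheaf.stalk s ⟶ Γ(Z, ⊤) :=
    CommRingCat.ofHom (IsLocalization.lift (S := S.presheaf.stalk s) hunit)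
  have hψ : S.presheaf.germ V s hsV ≫ ψ = φ := by
    ext x
    exact IsLocalization.lift_eq (S := S.presheaf.stalk s) hunit x
  refine ⟨Z.topIso.inv ≫ (⊤ : Z.Opens).toSpecΓ ≫ Spec.map ψ, ?_⟩
  rw [← hV.fromSpecStalk_eq_fromSpecStalk hsV, IsAffineOpen.fromSpecStalk]
  simp only [Category.assoc]
  rw [← Spec.map_comp_assoc, hψ, Scheme.Opens.toSpecΓ_SpecMap_appLE_assoc,
    IsAffineOpen.toSpecΓ_fromSpec, Scheme.Hom.resLE_comp_ι, ← Scheme.topIso_hom, Iso.inv_hom_id_assoc]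

/-- affine open neighbourhoods -/
abbrev AffNhd (S : Scheme.{u}) (s : S) : Type u := {V : S.Opens // IsAffineOpen V ∧ s ∈ V}

theorem affNhd_exists_le {S : Scheme.{u}} {s : S} (V : S.Opens) (hV : s ∈ V) :
    ∃ W : AffNhd S s, W.1 ≤ V := by
  obtain ⟨_, ⟨W, hW, rfl⟩, hsW, h⟩ :=
    S.isBasis_affineOpens.exists_subset_of_mem_open (show s ∈ (V : Set S) from hV) V.isOpen
  exact ⟨⟨W, hW, hsW⟩, h⟩

instance {S : Scheme.{u}} (s : S) : IsCofiltered (AffNhd S s) := by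
  have : Nonempty (AffNhd S s) := ⟨(affNhd_exists_le ⊤ trivial).choose⟩
  have : IsDirected (AffNhd S s) (· ≥ ·) := ⟨fun V W ↦ by
    obtain ⟨Z, hZ⟩ := affNhd_exists_le (s := s) (V.1 ⊓ W.1) ⟨V.2.2, W.2.2⟩
    exact ⟨Z, hZ.trans inf_le_left, hZ.trans inf_le_right⟩⟩
  infer_instance

/-- The diagram of preimages of affine open neighbourhoods. -/
noncomputable abbrev nhdDiagram {S X : Scheme.{u}} (s : S) (x : X ⟶ S) : AffNhd S s ⥤ Scheme.{u} where
  obj V := (x ⁻¹ᵁ V.1 : X.Opens)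
  map {V W} h := X.homOfLE (x.preimage_mono h.le)
  map_id _ := by simp
  map_comp _ _ := by simp

/-- The structure map. -/
noncomputable abbrev nhdDiagramι {S X : Scheme.{u}} (s : S) (x : X ⟶ S) :
    nhdDiagram s x ⟶ (Functor.const _).obj S where
  app V := (x ⁻¹ᵁ V.1).ι ≫ x
  naturality _ _ _ := by simp [nhdDiagram]

theorem range_aux {S X Xt : Scheme.{u}} {s : S} {x : X ⟶ S} {π : Xt ⟶ X}
    {xt : Xt ⟶ Spec (S.presheaf.stalk s)} (h : π ≫ x = xt ≫ S.fromSpecStalk s) (V : S.Opens) (hV : s ∈ V) :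
    Set.range π ⊆ Set.range (x ⁻¹ᵁ V).ι := by
  rw [Scheme.Opens.range_ι]
  rintro _ ⟨z, rfl⟩
  show x (π z) ∈ V
  rw [← Scheme.Hom.comp_apply, h, Scheme.Hom.comp_apply]
  have : S.fromSpecStalk s (xt z) ∈ Set.range (S.fromSpecStalk s) := ⟨_, rfl⟩
  rw [Scheme.range_fromSpecStalk] at this
  exact this.mem_open V.isOpen hV

/-- The map to the preimage of a neighbourhood -/
noncomputable def toNhd {S X Xt : Scheme.{u}} {s : S} {x : X ⟶ S} {π : Xt ⟶ X}
    {xt : Xt ⟶ Spec (S.presheaf.stalk s)} (h : π ≫ x = xt ≫ S.fromSpecStalk s) (V : S.Opens) (hV : s ∈ V) :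
    Xt ⟶ (x ⁻¹ᵁ V : X.Opens) :=
  IsOpenImmersion.lift (x ⁻¹ᵁ V).ι π (range_aux h V hV)

@[simp]
theorem toNhd_ι {S X Xt : Scheme.{u}} {s : S} {x : X ⟶ S} {π : Xt ⟶ X}
    {xt : Xt ⟶ Spec (S.presheaf.stalk s)} (h : π ≫ x = xt ≫ S.fromSpecStalk s) (V : S.Opens) (hV : s ∈ V) :
    toNhd h V hV ≫ (x ⁻¹ᵁ V).ι = π :=
  IsOpenImmersion.lift_fac _ _ _

@[simp]
theorem toNhd_ι_assoc {S X Xt Y : Scheme.{u}} {s : S} {x : X ⟶ S} {π : Xt ⟶ X}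
    {xt : Xt ⟶ Spec (S.presheaf.stalk s)} (h : π ≫ x = xt ≫ S.fromSpecStalk s) (V : S.Opens)
    (hV : s ∈ V) (k : X ⟶ Y) :
    toNhd h V hV ≫ (x ⁻¹ᵁ V).ι ≫ k = π ≫ k := by
  rw [← Category.assoc, toNhd_ι]

/-- The cone -/
noncomputable abbrev nhdCone {S X Xt : Scheme.{u}} {s : S} {x : X ⟶ S} {π : Xt ⟶ X}
    {xt : Xt ⟶ Spec (S.presheaf.stalk s)} (h : π ≫ x = xt ≫ S.fromSpecStalk s) :
    Cone (nhdDiagram s x) where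
  pt := Xt
  π := { app V := toNhd h V.1 V.2.2
         naturality V W f := by
          dsimp only [nhdDiagram, Functor.const_obj_obj, Functor.const_obj_map]
          rw [← cancel_mono (x ⁻¹ᵁ W.1).ι]
          simp }

theorem nhdCone_isLimit {S X Xt : Scheme.{u}} {s : S} {x : X ⟶ S} {π : Xt ⟶ X}
    {xt : Xt ⟶ Spec (S.presheaf.stalk s)} (h : IsPullback π xt x (S.fromSpecStalk s)) :
    Nonempty (IsLimit (nhdCone h.w)) := by
  have V₀ : AffNhd S s := (affNhd_exists_le ⊤ trivial).choose
  have key (c : Cone (nhdDiagram s x)) (V W) :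
      c.π.app V ≫ (x ⁻¹ᵁ V.1).ι = c.π.app W ≫ (x ⁻¹ᵁ W.1).ι := by
    obtain ⟨Z, hZ⟩ := affNhd_exists_le (s := s) (V.1 ⊓ W.1) ⟨V.2.2, W.2.2⟩
    have h1 := c.w (homOfLE (show Z ≤ V from hZ.trans inf_le_left) : Z ⟶ V)
    have h2 := c.w (homOfLE (show Z ≤ W from hZ.trans inf_le_right) : Z ⟶ W)
    rw [← h1, ← h2]
    simp [nhdDiagram]
  have key2 (c : Cone (nhdDiagram s x)) :
      ∃ w : c.pt ⟶ Spec (S.presheaf.stalk s), w ≫ S.fromSpecStalk s =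
        (c.π.app V₀ ≫ (x ⁻¹ᵁ V₀.1).ι) ≫ x := by
    apply exists_factor_fromSpecStalk
    intro V hV hs
    rw [key c V₀ ⟨V, hV, hs⟩]
    dsimp only [nhdDiagram]
    rw [Scheme.Hom.comp_preimage, Scheme.Hom.comp_preimage]
    simp
  choose w hw using key2
  refine ⟨⟨fun c ↦ h.lift (c.π.app V₀ ≫ (x ⁻¹ᵁ V₀.1).ι) (w c) (hw c).symm, ?_, ?_⟩⟩
  · intro c V
    dsimp only [nhdDiagram, nhdCone]
    rw [← cancel_mono (x ⁻¹ᵁ V.1).ι, Category.assoc, toNhd_ι, h.lift_fst]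
    exact key c V₀ V
  · intro c m hm
    dsimp only [nhdDiagram, nhdCone] at m hm ⊢
    apply h.hom_ext
    · rw [h.lift_fst, ← hm V₀]
      simp
    · rw [← cancel_mono (S.fromSpecStalk s), h.lift_snd, hw, ← hm V₀, Category.assoc, ← h.w]
      simp

theorem nhd_compact {S X : Scheme.{u}} (x : X ⟶ S) [QuasiCompact x] [QuasiSeparated x]
    {V : S.Opens} (hV : IsAffineOpen V) : CompactSpace (x ⁻¹ᵁ V : X.Opens) ∧
      QuasiSeparatedSpace (x ⁻¹ᵁ V : X.Opens) := by
  have : IsAffine V := hV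
  exact ⟨isCompact_iff_compactSpace.mp (x.isCompact_preimage hV.isCompact),
    quasiSeparatedSpace_of_quasiSeparated (x ∣_ V)⟩

theorem nhd_affineHom {S X : Scheme.{u}} (x : X ⟶ S) {V W : S.Opens} (hV : IsAffineOpen V)
    (hW : IsAffineOpen W) (e : V ≤ W) : IsAffineHom (X.homOfLE (x.preimage_mono e)) := by
  have : IsAffine V := hV
  have : IsAffine W := hW
  have h1 : IsPullback (X.homOfLE (x.preimage_mono e)) (x ∣_ V) (x ∣_ W) (S.homOfLE e) := by
    apply IsPullback.of_right (h₁₂ := (x ⁻¹ᵁ W).ι) (h₂₂ := W.ι) (v₁₃ := x)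
    · simpa using (isPullback_morphismRestrict x V).flip
    · rw [← cancel_mono W.ι]; simp
    · exact (isPullback_morphismRestrict x W).flip
  exact MorphismProperty.of_isPullback (P := @IsAffineHom) h1.flip inferInstance

theorem nhd_spread {S X Xt N : Scheme.{u}} {s : S} {x : X ⟶ S} {π : Xt ⟶ X}
    {xt : Xt ⟶ Spec (S.presheaf.stalk s)} (h : IsPullback π xt x (S.fromSpecStalk s))
    [QuasiCompact x] [QuasiSeparated x] (p : N ⟶ S) [LocallyOfFinitePresentation p]
    (f : Xt ⟶ N) (hf : f ≫ p = π ≫ x) :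
    ∃ (V : S.Opens) (hV : s ∈ V) (g : ↑(x ⁻¹ᵁ V) ⟶ N),
      toNhd h.w V hV ≫ g = f ∧ g ≫ p = (x ⁻¹ᵁ V).ι ≫ x := by
  obtain ⟨hl⟩ := nhdCone_isLimit h
  have (V : AffNhd S s) : CompactSpace ((nhdDiagram s x).obj V) := (nhd_compact x V.2.1).1
  have (V : AffNhd S s) : QuasiSeparatedSpace ((nhdDiagram s x).obj V) := (nhd_compact x V.2.1).2
  have {V W : AffNhd S s} (e : V ⟶ W) : IsAffineHom ((nhdDiagram s x).map e) := by
    have : IsAffine V.1 := V.2.1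
    have : IsAffine W.1 := W.2.1
    exact nhd_affineHom x V.2.1 W.2.1 e.le
  obtain ⟨V, g, h1, h2⟩ := Scheme.exists_π_app_comp_eq_of_locallyOfFinitePresentation
    (nhdDiagram s x) (nhdDiagramι s x) p _ hl f (by
      ext V
      simp [nhdCone, nhdDiagramι, hf])
  exact ⟨V.1, V.2.2, g, h1, h2⟩

theorem nhd_spread_eq {S X Xt N : Scheme.{u}} {s : S} {x : X ⟶ S} {π : Xt ⟶ X}
    {xt : Xt ⟶ Spec (S.presheaf.stalk s)} (h : IsPullback π xt x (S.fromSpecStalk s))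
    [QuasiCompact x] [QuasiSeparated x] (p : N ⟶ S) [LocallyOfFiniteType p]
    (V : S.Opens) (hV : s ∈ V) (g₁ g₂ : ↑(x ⁻¹ᵁ V) ⟶ N) 
    (h₁ : g₁ ≫ p = (x ⁻¹ᵁ V).ι ≫ x) (h₂ : g₂ ≫ p = (x ⁻¹ᵁ V).ι ≫ x)
    (heq : toNhd h.w V hV ≫ g₁ = toNhd h.w V hV ≫ g₂) :
    ∃ (W : S.Opens) (_ : s ∈ W) (e : W ≤ V), X.homOfLE (x.preimage_mono e) ≫ g₁ = 
      X.homOfLE (x.preimage_mono e) ≫ g₂ := by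
  obtain ⟨hl⟩ := nhdCone_isLimit h
  have (V : AffNhd S s) : CompactSpace ((nhdDiagram s x).obj V) := (nhd_compact x V.2.1).1
  have {V W : AffNhd S s} (e : V ⟶ W) : IsAffineHom ((nhdDiagram s x).map e) := by
    have : IsAffine V.1 := V.2.1
    have : IsAffine W.1 := W.2.1
    exact nhd_affineHom x V.2.1 W.2.1 e.le
  obtain ⟨V', hV'⟩ := affNhd_exists_le V hV
  have aux : toNhd h.w V hV = toNhd h.w V'.1 V'.2.2 ≫ X.homOfLE (x.preimage_mono hV') := by
    rw [← cancel_mono (x ⁻¹ᵁ V).ι]; simp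
  obtain ⟨W, e, hW⟩ := Scheme.exists_hom_comp_eq_comp_of_locallyOfFiniteType
    (nhdDiagram s x) (nhdDiagramι s x) p _ hl (i := V') (X.homOfLE (x.preimage_mono hV') ≫ g₁)
      (X.homOfLE (x.preimage_mono hV') ≫ g₂) (by simp [h₁]) (by simp [h₂]) 
      (by simpa [aux] using heq)
  refine ⟨W.1, W.2.2, (show W.1 ≤ V'.1 from e.le).trans hV', ?_⟩
  simpa [nhdDiagram] using hW

theorem smooth_spread_aux {T B X V S Z : Scheme.{u}} {q : T ⟶ B} {t : T ⟶ X} {b : B ⟶ Z}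
    {i : X ⟶ Z} (h : IsPullback q t b i) (f' : V ⟶ Z) (j : X ⟶ V) (hi : i = j ≫ f')
    (v : V ⟶ S) [Mono v] {k : X ⟶ S} (hj : j ≫ v = k) :
    ∃ π : T ⟶ pullback f' b, IsPullback π t (pullback.fst f' b ≫ v) k := by
  let π : T ⟶ pullback f' b := pullback.lift (t ≫ j) q (by rw [h.w, hi, Category.assoc])
  refine ⟨π, ?_⟩
  have h1 : IsPullback π t (pullback.fst f' b) j := by
    apply IsPullback.of_right (h₁₂ := pullback.snd f' b) (h₂₂ := f') (v₁₃ := b)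
    · rw [pullback.lift_snd, ← hi]
      exact h
    · exact pullback.lift_fst _ _ _
    · exact (IsPullback.of_hasPullback f' b).flip
  have h2 : IsPullback j (𝟙 _) v k := by
    refine ⟨⟨by simp [hj]⟩, ⟨PullbackCone.IsLimit.mk _ (fun c ↦ c.snd) ?_ ?_ ?_⟩⟩
    · intro c
      rw [← cancel_mono v, Category.assoc, hj, c.condition]
    · simp
    · intro c m h1 h2
      simpa using h2
  simpa using h1.paste_vert h2

theorem smooth_spread {S T : Scheme.{u}} [IsLocallyNoetherian S] (s : S)
    (t : T ⟶ Spec (S.presheaf.stalk s)) [Smooth t] [IsAffine T] :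
    ∃ (T' : Scheme.{u}) (t' : T' ⟶ S) (π : T ⟶ T'), IsAffine T' ∧ Smooth t' ∧
      IsPullback π t t' (S.fromSpecStalk s) := by
  let A := S.presheaf.stalk s
  let B := Γ(T, ⊤)
  let φ : A ⟶ B := Spec.preimage (T.isoSpec.inv ≫ t)
  have hφ : T.isoSpec.hom ≫ Spec.map φ = t := by simp [φ]
  have hsm : φ.hom.Smooth := by
    rw [← HasRingHomProperty.Spec_iff (P := @Smooth)]
    simp only [φ, Spec.map_preimage]
    infer_instance
  let : Algebra A B := φ.hom.toAlgebra
  have : Algebra.Smooth A B := hsm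
  let : Algebra (ULift.{u} ℤ) A :=
    ((Int.castRingHom A).comp (ULift.ringEquiv (R := ℤ)).toRingHom).toAlgebra
  obtain ⟨A₀, B₀, _, _, hA₀, hB₀, ⟨e⟩⟩ := Algebra.Smooth.exists_subalgebra_fg (ULift.{u} ℤ) A B
  have hft : Algebra.FiniteType (ULift.{u} ℤ) A₀ := ⟨A₀.fg_top.mpr hA₀⟩
  let sY : Spec (CommRingCat.of A₀) ⟶ Spec (CommRingCat.of (ULift.{u} ℤ)) :=
    Spec.map (CommRingCat.ofHom (algebraMap _ _))
  have : LocallyOfFiniteType sY := by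
    rw [HasRingHomProperty.Spec_iff (P := @LocallyOfFiniteType)]
    exact RingHom.finiteType_algebraMap.mpr hft
  let i : Spec A ⟶ Spec (CommRingCat.of A₀) := Spec.map (CommRingCat.ofHom (algebraMap A₀ A))
  obtain ⟨U, hsU, f, hf, -⟩ := spread_out_of_isGermInjective' (specULiftZIsTerminal.from S) sY
    (x := s) i (specULiftZIsTerminal.hom_ext _ _)
  obtain ⟨⟨V, hV, hsV⟩, hVU⟩ := affNhd_exists_le U hsU
  have : IsAffine V := hV
  let f' : V.toScheme ⟶ Spec (CommRingCat.of A₀) := S.homOfLE hVU ≫ f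
  let j : Spec A ⟶ V := V.fromSpecStalkOfMem s hsV
  have hj : j ≫ V.ι = S.fromSpecStalk s := by simp [j]
  have hi : i = j ≫ f' := by
    rw [hf]
    simp only [f', ← Category.assoc]
    congr 1
    rw [← cancel_mono U.ι]
    simp [j]
  let b : Spec (CommRingCat.of B₀) ⟶ Spec (CommRingCat.of A₀) :=
    Spec.map (CommRingCat.ofHom (algebraMap A₀ B₀))
  have hb : Smooth b := by
    rw [HasRingHomProperty.Spec_iff (P := @Smooth)]
    exact RingHom.smooth_algebraMap.mpr hB₀
  let ψ : CommRingCat.of B₀ ⟶ B := CommRingCat.ofHom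
    (e.symm.toAlgHom.toRingHom.comp Algebra.TensorProduct.includeRight.toRingHom)
  have hpo : IsPushout (CommRingCat.ofHom (algebraMap A₀ A)) (CommRingCat.ofHom (algebraMap A₀ B₀)) φ ψ := by
    refine (CommRingCat.isPushout_tensorProduct A₀ A B₀).of_iso (Iso.refl _) (Iso.refl _) (Iso.refl _)
      (RingEquiv.toCommRingCatIso e.symm.toRingEquiv) ?_ ?_ ?_ ?_
    · rfl
    · rfl
    · ext x
      exact e.symm.commutes x
    · rfl
  have hpb := isPullback_SpecMap_of_isPushout _ _ _ _ hpo
  have hpb2 : IsPullback (T.isoSpec.hom ≫ Spec.map ψ) t b i := by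
    refine hpb.flip.of_iso T.isoSpec.symm (Iso.refl _) (Iso.refl _) (Iso.refl _) ?_ ?_ ?_ ?_
    · simp
    · simp [← hφ]
    · simp [b]
    · exact (Category.comp_id _).trans (Category.id_comp _).symm
  obtain ⟨π, hπ⟩ := smooth_spread_aux hpb2 f' j hi V.ι hj
  exact ⟨pullback f' b, pullback.fst f' b ≫ V.ι, π, inferInstance, inferInstance, hπ⟩

/-- The mapping property of a Néron model, phrased without reference to the generic fibre. -/
def NeronProp {S U N : Scheme.{u}} (ι : U ⟶ S) (p : N ⟶ S) : Prop :=
  ∀ ⦃T : Scheme.{u}⦄ (t : T ⟶ S), Smooth t → ∀ ⦃P : Scheme.{u}⦄ (fst : P ⟶ T) (snd : P ⟶ U),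
    IsPullback fst snd t ι → ∀ f : P ⟶ N, f ≫ p = fst ≫ t →
      ∃! g : T ⟶ N, g ≫ p = t ∧ fst ≫ g = f

theorem nhd_pb {S U T : Scheme.{u}} (ι : U ⟶ S) (t : T ⟶ S) (V : S.Opens) :
    ∃ q : ((pullback.fst t ι ≫ t) ⁻¹ᵁ V).toScheme ⟶ (t ⁻¹ᵁ V).toScheme,
      q ≫ (t ⁻¹ᵁ V).ι = ((pullback.fst t ι ≫ t) ⁻¹ᵁ V).ι ≫ pullback.fst t ι ∧
      IsPullback q (((pullback.fst t ι ≫ t) ⁻¹ᵁ V).ι ≫ pullback.snd t ι) ((t ⁻¹ᵁ V).ι ≫ t) ι := by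
  have h := (isPullback_morphismRestrict (pullback.fst t ι) (t ⁻¹ᵁ V)).flip
  have h2 := h.paste_horiz (IsPullback.of_hasPullback t ι).flip
  exact ⟨pullback.fst t ι ∣_ (t ⁻¹ᵁ V), h.w.symm, h2.flip⟩

set_option linter.unusedSectionVars false

section core

variable {S U N T T' P : Scheme.{u}} [IsLocallyNoetherian S] {s : S} {ι : U ⟶ S}
  [IsOpenImmersion ι] {p : N ⟶ S}
  {t : T ⟶ Spec (S.presheaf.stalk s)} {t' : T' ⟶ S} {π : T ⟶ T'}
  {fst : P ⟶ T} {snd : P ⟶ U}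

theorem core_pb (hT : IsPullback π t t' (S.fromSpecStalk s))
    (hP : IsPullback fst snd (t ≫ S.fromSpecStalk s) ι) :
    ∃ πP : P ⟶ pullback t' ι, πP ≫ pullback.fst t' ι = fst ≫ π ∧
      IsPullback πP (fst ≫ t) (pullback.fst t' ι ≫ t') (S.fromSpecStalk s) := by
  let πP : P ⟶ pullback t' ι := pullback.lift (fst ≫ π) snd (by
    rw [Category.assoc, hT.w, hP.w])
  have h1 : πP ≫ pullback.fst t' ι = fst ≫ π := pullback.lift_fst _ _ _
  have h2 : πP ≫ pullback.snd t' ι = snd := pullback.lift_snd _ _ _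
  refine ⟨πP, h1, ?_⟩
  have h3 : IsPullback πP fst (pullback.fst t' ι) π := by
    apply IsPullback.of_right (h₁₂ := pullback.snd t' ι) (h₂₂ := t') (v₁₃ := ι)
    · rw [h2, hT.w]
      exact hP.flip
    · exact h1
    · exact (IsPullback.of_hasPullback t' ι).flip
  exact h3.paste_vert hT

theorem core_exists (hN : NeronProp ι p) [Smooth p] [IsAffine T'] [Smooth t']
    (hT : IsPullback π t t' (S.fromSpecStalk s))
    (hP : IsPullback fst snd (t ≫ S.fromSpecStalk s) ι) (f : P ⟶ N)
    (hf : f ≫ p = fst ≫ t ≫ S.fromSpecStalk s) :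
    ∃ g : T ⟶ N, g ≫ p = t ≫ S.fromSpecStalk s ∧ fst ≫ g = f := by
  obtain ⟨πP, h1, hpb⟩ := core_pb hT hP
  have : IsLocallyNoetherian T' := LocallyOfFiniteType.isLocallyNoetherian t'
  have hw := hpb.w
  obtain ⟨V, hV, g'', hg1, hg2⟩ := nhd_spread hpb p f (by rw [hf, hpb.w, Category.assoc])
  obtain ⟨q, hq, hq2⟩ := nhd_pb ι t' V
  obtain ⟨g, ⟨hg3, hg4⟩, -⟩ := hN ((t' ⁻¹ᵁ V).ι ≫ t') inferInstance q _ hq2 g'' (by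
    rw [hg2, reassoc_of% hq])
  refine ⟨toNhd hT.w V hV ≫ g, ?_, ?_⟩
  · rw [Category.assoc, hg3, toNhd_ι_assoc, hT.w]
  · have : fst ≫ toNhd hT.w V hV = toNhd hpb.w V hV ≫ q := by
      rw [← cancel_mono (t' ⁻¹ᵁ V).ι, Category.assoc, toNhd_ι, Category.assoc, hq,
        toNhd_ι_assoc, h1]
    rw [reassoc_of% this, hg4, hg1]

theorem core_unique (hN : NeronProp ι p) [Smooth p] [IsAffine T'] [Smooth t']
    (hT : IsPullback π t t' (S.fromSpecStalk s))
    (hP : IsPullback fst snd (t ≫ S.fromSpecStalk s) ι) (g₁ g₂ : T ⟶ N)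
    (h₁ : g₁ ≫ p = t ≫ S.fromSpecStalk s) (h₂ : g₂ ≫ p = t ≫ S.fromSpecStalk s)
    (h : fst ≫ g₁ = fst ≫ g₂) : g₁ = g₂ := by
  obtain ⟨πP, hπP, hpb⟩ := core_pb hT hP
  have : IsLocallyNoetherian T' := LocallyOfFiniteType.isLocallyNoetherian t'
  obtain ⟨V₁, hV₁, k₁, hk₁, hk₁p⟩ := nhd_spread hT p g₁ (by rw [h₁, hT.w])
  obtain ⟨V₂, hV₂, k₂, hk₂, hk₂p⟩ := nhd_spread hT p g₂ (by rw [h₂, hT.w])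
  have hV : s ∈ V₁ ⊓ V₂ := ⟨hV₁, hV₂⟩
  generalize hVdef : V₁ ⊓ V₂ = V at hV
  have e₁ : V ≤ V₁ := hVdef ▸ inf_le_left
  have e₂ : V ≤ V₂ := hVdef ▸ inf_le_right
  have htn : ∀ {V W : S.Opens} (hV : s ∈ V) (hW : s ∈ W) (e : W ≤ V),
      toNhd hT.w W hW ≫ T'.homOfLE (t'.preimage_mono e) = toNhd hT.w V hV := by
    intro V W hV hW e
    rw [← cancel_mono (t' ⁻¹ᵁ V).ι, Category.assoc, Scheme.homOfLE_ι, toNhd_ι, toNhd_ι]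
  obtain ⟨l₁, hl₁, hl₁p⟩ : ∃ l : (t' ⁻¹ᵁ V).toScheme ⟶ N, toNhd hT.w V hV ≫ l = g₁ ∧
      l ≫ p = (t' ⁻¹ᵁ V).ι ≫ t' :=
    ⟨T'.homOfLE (t'.preimage_mono e₁) ≫ k₁, by rw [← Category.assoc, htn hV₁ hV e₁, hk₁], by
      rw [Category.assoc, hk₁p, Scheme.homOfLE_ι_assoc]⟩
  obtain ⟨l₂, hl₂, hl₂p⟩ : ∃ l : (t' ⁻¹ᵁ V).toScheme ⟶ N, toNhd hT.w V hV ≫ l = g₂ ∧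
      l ≫ p = (t' ⁻¹ᵁ V).ι ≫ t' :=
    ⟨T'.homOfLE (t'.preimage_mono e₂) ≫ k₂, by rw [← Category.assoc, htn hV₂ hV e₂, hk₂], by
      rw [Category.assoc, hk₂p, Scheme.homOfLE_ι_assoc]⟩
  obtain ⟨q, hq, hq2⟩ := nhd_pb ι t' V
  have hfq : toNhd hpb.w V hV ≫ q = fst ≫ toNhd hT.w V hV := by
    rw [← cancel_mono (t' ⁻¹ᵁ V).ι, Category.assoc, Category.assoc, toNhd_ι, hq,
        toNhd_ι_assoc, hπP]
  obtain ⟨W, hW, e, he⟩ := nhd_spread_eq hpb p V hV (q ≫ l₁) (q ≫ l₂)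
    (by rw [Category.assoc, hl₁p, reassoc_of% hq]) (by rw [Category.assoc, hl₂p, reassoc_of% hq])
    (by rw [reassoc_of% hfq, reassoc_of% hfq, hl₁, hl₂, h])
  obtain ⟨q', hq', hq2'⟩ := nhd_pb ι t' W
  have hqq : q' ≫ T'.homOfLE (t'.preimage_mono e) =
      (pullback t' ι).homOfLE ((pullback.fst t' ι ≫ t').preimage_mono e) ≫ q := by
    rw [← cancel_mono (t' ⁻¹ᵁ V).ι, Category.assoc, Category.assoc, Scheme.homOfLE_ι, hq, hq',
      Scheme.homOfLE_ι_assoc]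
  have key : T'.homOfLE (t'.preimage_mono e) ≫ l₁ = T'.homOfLE (t'.preimage_mono e) ≫ l₂ := by
    refine (hN ((t' ⁻¹ᵁ W).ι ≫ t') inferInstance q' _ hq2'
      (q' ≫ T'.homOfLE (t'.preimage_mono e) ≫ l₁) ?_).unique ⟨?_, rfl⟩ ⟨?_, ?_⟩
    · rw [Category.assoc, Category.assoc, hl₁p, Scheme.homOfLE_ι_assoc]
    · rw [Category.assoc, hl₁p, Scheme.homOfLE_ι_assoc]
    · rw [Category.assoc, hl₂p, Scheme.homOfLE_ι_assoc]
    · rw [reassoc_of% hqq, reassoc_of% hqq, he]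
  rw [← hl₁, ← hl₂, ← htn hV hW e, Category.assoc, Category.assoc, key]

theorem neronProp_unique (hN : NeronProp ι p) [Smooth p] [Smooth t]
    (hP : IsPullback fst snd (t ≫ S.fromSpecStalk s) ι) (g₁ g₂ : T ⟶ N)
    (h₁ : g₁ ≫ p = t ≫ S.fromSpecStalk s) (h₂ : g₂ ≫ p = t ≫ S.fromSpecStalk s)
    (h : fst ≫ g₁ = fst ≫ g₂) : g₁ = g₂ := by
  refine T.affineCover.hom_ext _ _ fun i ↦ ?_
  obtain ⟨T', t', π, _, _, hT⟩ := smooth_spread s (T.affineCover.f i ≫ t)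
  have hb := IsPullback.of_hasPullback (T.affineCover.f i) fst
  refine core_unique hN hT (fst := pullback.fst (T.affineCover.f i) fst)
    (snd := pullback.snd (T.affineCover.f i) fst ≫ snd) ?_ _ _ ?_ ?_ ?_
  · simpa using (hb.flip.paste_horiz hP.flip).flip
  · simp [h₁]
  · simp [h₂]
  · rw [← Category.assoc, ← Category.assoc, hb.w, Category.assoc, Category.assoc, h]

theorem neronProp_exists (hN : NeronProp ι p) [Smooth p] [Smooth t]
    (hP : IsPullback fst snd (t ≫ S.fromSpecStalk s) ι) (f : P ⟶ N)
    (hf : f ≫ p = fst ≫ t ≫ S.fromSpecStalk s) :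
    ∃ g : T ⟶ N, g ≫ p = t ≫ S.fromSpecStalk s ∧ fst ≫ g = f := by
  have hloc : ∀ i, ∃ g : T.affineCover.X i ⟶ N,
      g ≫ p = T.affineCover.f i ≫ t ≫ S.fromSpecStalk s ∧
      pullback.fst (T.affineCover.f i) fst ≫ g = pullback.snd (T.affineCover.f i) fst ≫ f := by
    intro i
    obtain ⟨T', t', π, _, _, hT⟩ := smooth_spread s (T.affineCover.f i ≫ t)
    have hb := IsPullback.of_hasPullback (T.affineCover.f i) fst
    simpa using core_exists hN hT (fst := pullback.fst (T.affineCover.f i) fst)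
      (snd := pullback.snd (T.affineCover.f i) fst ≫ snd)
      (by simpa using (hb.flip.paste_horiz hP.flip).flip)
      (pullback.snd (T.affineCover.f i) fst ≫ f)
      (by rw [Category.assoc, hf, Category.assoc, ← reassoc_of% hb.w])
  choose g hg1 hg2 using hloc
  have hov : ∀ i j, pullback.fst (T.affineCover.f i) (T.affineCover.f j) ≫ g i =
      pullback.snd (T.affineCover.f i) (T.affineCover.f j) ≫ g j := by
    intro i j
    let fi := T.affineCover.f i
    let fj := T.affineCover.f j
    have hb := IsPullback.of_hasPullback (pullback.fst fi fj ≫ fi) fst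
    refine neronProp_unique hN (t := pullback.fst fi fj ≫ fi ≫ t)
      (fst := pullback.fst (pullback.fst fi fj ≫ fi) fst)
      (snd := pullback.snd (pullback.fst fi fj ≫ fi) fst ≫ snd) ?_ _ _ ?_ ?_ ?_
    · simpa using (hb.flip.paste_horiz hP.flip).flip
    · simp [hg1, fi, fj]
    · rw [Category.assoc, hg1]
      simp [fi, fj, pullback.condition_assoc]
    · have a1 : pullback.fst (pullback.fst fi fj ≫ fi) fst ≫ pullback.fst fi fj =
          pullback.lift (pullback.fst (pullback.fst fi fj ≫ fi) fst ≫ pullback.fst fi fj)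
            (pullback.snd (pullback.fst fi fj ≫ fi) fst) (by rw [Category.assoc, hb.w]) ≫
            pullback.fst fi fst := (pullback.lift_fst _ _ _).symm
      have a2 : pullback.fst (pullback.fst fi fj ≫ fi) fst ≫ pullback.snd fi fj =
          pullback.lift (pullback.fst (pullback.fst fi fj ≫ fi) fst ≫ pullback.snd fi fj)
            (pullback.snd (pullback.fst fi fj ≫ fi) fst)
            (by rw [Category.assoc, ← pullback.condition (f := fi) (g := fj), hb.w]) ≫
            pullback.fst fj fst := (pullback.lift_fst _ _ _).symm
      rw [reassoc_of% a1, reassoc_of% a2, hg2, hg2, pullback.lift_snd_assoc,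
        pullback.lift_snd_assoc]
  refine ⟨T.affineCover.glueMorphisms g hov, ?_, ?_⟩
  · refine T.affineCover.hom_ext _ _ fun i ↦ ?_
    rw [Scheme.Cover.ι_glueMorphisms_assoc, hg1]
  · refine Scheme.Cover.hom_ext (T.affineCover.pullback₁ fst) _ _ fun i ↦ ?_
    have key : ∀ i : T.affineCover.I₀, pullback.fst fst (T.affineCover.f i) ≫ fst ≫
        T.affineCover.glueMorphisms g hov = pullback.fst fst (T.affineCover.f i) ≫ f := by
      intro i
      have h2 : pullback.fst fst (T.affineCover.f i) =
        (pullbackSymmetry _ _).hom ≫ pullback.snd (T.affineCover.f i) fst := by simp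
      rw [h2, Category.assoc, Category.assoc, ← hg2, ← pullback.condition_assoc,
        Scheme.Cover.ι_glueMorphisms]
    exact key i

end core

theorem neronProp_of_isNeronModel {S U A N : Scheme.{u}} (ι : U ⟶ S) (a : A ⟶ U)
    (p : N ⟶ S) (r : pullback p ι ⟶ A) (h : IsNeronModel ι a p r) : NeronProp ι p := by
  obtain ⟨_, _, _, _, _, hr, H⟩ := h
  intro T t ht P fst snd hP f hf
  let e := hP.isoPullback
  have he1 : e.inv ≫ fst = pullback.fst t ι := hP.isoPullback_inv_fst
  have he2 : e.inv ≫ snd = pullback.snd t ι := hP.isoPullback_inv_snd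
  have he3 : e.hom ≫ pullback.fst t ι = fst := hP.isoPullback_hom_fst
  let k : pullback t ι ⟶ pullback p ι := pullback.lift (e.inv ≫ f) (pullback.snd t ι) (by
    rw [Category.assoc, hf, ← Category.assoc, he1, pullback.condition])
  have hk1 : k ≫ pullback.fst p ι = e.inv ≫ f := pullback.lift_fst _ _ _
  have hk2 : k ≫ pullback.snd p ι = pullback.snd t ι := pullback.lift_snd _ _ _
  obtain ⟨g, ⟨hg1, hg2⟩, hg3⟩ := H T t ht (k ≫ r) (by rw [Category.assoc, hr, hk2])
  refine ⟨g, ⟨hg1, ?_⟩, ?_⟩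
  · let φ : pullback t ι ⟶ pullback p ι := pullback.lift (pullback.fst t ι ≫ g)
      (pullback.snd t ι) (by rw [Category.assoc, hg1, pullback.condition])
    have hφ1 : φ ≫ pullback.fst p ι = pullback.fst t ι ≫ g := pullback.lift_fst _ _ _
    have hφ := hg2 φ hφ1 (pullback.lift_snd _ _ _)
    rw [cancel_mono] at hφ
    rw [hφ, hk1] at hφ1
    rw [← he3, Category.assoc, ← hφ1, Iso.hom_inv_id_assoc]
  · rintro g' ⟨h1, h2⟩
    refine hg3 g' ⟨h1, fun φ hφ1 hφ2 ↦ ?_⟩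
    congr 1
    apply pullback.hom_ext
    · rw [hφ1, hk1, ← he1, Category.assoc, h2]
    · rw [hφ2, hk2]

theorem isNeronModel_of_neronProp {S U A N : Scheme.{u}} (ι : U ⟶ S) (a : A ⟶ U)
    (p : N ⟶ S) (r : pullback p ι ⟶ A) (h₁ : Smooth p) (h₂ : IsSeparated p) (h₄ : QuasiCompact p)
    (h₅ : IsIso r) (h₆ : r ≫ a = pullback.snd p ι) (H : NeronProp ι p) : IsNeronModel ι a p r := by
  refine ⟨h₁, h₂, inferInstance, h₄, h₅, h₆, ?_⟩
  intro T t ht f hf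
  have hra : inv r ≫ pullback.snd p ι = a := by rw [← h₆, IsIso.inv_hom_id_assoc]
  obtain ⟨g, ⟨hg1, hg2⟩, hg3⟩ := H t ht _ _ (IsPullback.of_hasPullback t ι)
    (f ≫ inv r ≫ pullback.fst p ι) (by
      rw [Category.assoc, Category.assoc, pullback.condition, reassoc_of% hra, reassoc_of% hf,
        pullback.condition])
  refine ⟨g, ⟨hg1, fun φ hφ1 hφ2 ↦ ?_⟩, ?_⟩
  · have : φ = f ≫ inv r := by
      apply pullback.hom_ext
      · rw [hφ1, hg2, Category.assoc]
      · rw [hφ2, Category.assoc, hra, hf]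
    rw [this, Category.assoc, IsIso.inv_hom_id, Category.comp_id]
  · rintro g' ⟨h1, h2⟩
    refine hg3 g' ⟨h1, ?_⟩
    let φ : pullback t ι ⟶ pullback p ι := pullback.lift (pullback.fst t ι ≫ g')
      (pullback.snd t ι) (by rw [Category.assoc, h1, pullback.condition])
    have hφ1 : φ ≫ pullback.fst p ι = pullback.fst t ι ≫ g' := pullback.lift_fst _ _ _
    have hφ := h2 φ hφ1 (pullback.lift_snd _ _ _)
    rw [← hφ1, ← hφ, Category.assoc, IsIso.hom_inv_id_assoc]

theorem neronProp_stalk {S U N : Scheme.{u}} [IsLocallyNoetherian S] (s : S) (ι : U ⟶ S)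
    [IsOpenImmersion ι] (p : N ⟶ S) [Smooth p] (hN : NeronProp ι p) :
    NeronProp (pullback.fst (S.fromSpecStalk s) ι) (pullback.snd p (S.fromSpecStalk s)) := by
  intro T t ht P fst snd hP f hf
  have hP' : IsPullback fst (snd ≫ pullback.snd (S.fromSpecStalk s) ι)
      (t ≫ S.fromSpecStalk s) ι :=
    (hP.flip.paste_horiz (IsPullback.of_hasPullback (S.fromSpecStalk s) ι).flip).flip
  obtain ⟨g, hg1, hg2⟩ := neronProp_exists hN hP' (f ≫ pullback.fst p (S.fromSpecStalk s)) (by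
    rw [Category.assoc, pullback.condition, reassoc_of% hf])
  let g' : T ⟶ pullback p (S.fromSpecStalk s) := pullback.lift g t hg1
  have hg'1 : g' ≫ pullback.fst p (S.fromSpecStalk s) = g := pullback.lift_fst _ _ _
  have hg'2 : g' ≫ pullback.snd p (S.fromSpecStalk s) = t := pullback.lift_snd _ _ _
  refine ⟨g', ⟨hg'2, ?_⟩, ?_⟩
  · apply pullback.hom_ext
    · rw [Category.assoc, hg'1, hg2]
    · rw [Category.assoc, hg'2, hf]
  · rintro k ⟨hk1, hk2⟩
    apply pullback.hom_ext
    · refine neronProp_unique hN hP' _ _ ?_ ?_ ?_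
      · rw [Category.assoc, pullback.condition, reassoc_of% hk1]
      · rw [hg'1, hg1]
      · rw [hg'1, hg2, reassoc_of% hk2]
    · rw [hk1, hg'2]


/-- over a locally noetherian base, Néron models are stable under base change
to the spectrum `S̃ = Spec 𝒪_{S,s}` of the local ring at a point `s` of `S` (with its
canonical morphism `S.fromSpecStalk s : S̃ ⟶ S`). Notation as in the smooth base change
statement, with `s' := S.fromSpecStalk s`. -/
theorem neron_model_localization {S U A N : Scheme} [IsLocallyNoetherian S]
    (ι : U ⟶ S) [IsOpenImmersion ι]
    (a : A ⟶ U) (p : N ⟶ S) (r : pullback p ι ⟶ A) (h : IsNeronModel ι a p r)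
    (s : S) (s' : Spec (S.presheaf.stalk s) ⟶ S) (hs' : s' = S.fromSpecStalk s) :
    ∃ r₂ : pullback (pullback.snd p s') (pullback.fst s' ι) ⟶ pullback a (pullback.snd s' ι),
      (∀ φ : pullback (pullback.snd p s') (pullback.fst s' ι) ⟶ pullback p ι,
          φ ≫ pullback.fst p ι =
            pullback.fst (pullback.snd p s') (pullback.fst s' ι) ≫ pullback.fst p s' →
          φ ≫ pullback.snd p ι =
            pullback.snd (pullback.snd p s') (pullback.fst s' ι) ≫ pullback.snd s' ι →
          r₂ ≫ pullback.fst a (pullback.snd s' ι) = φ ≫ r) ∧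
      r₂ ≫ pullback.snd a (pullback.snd s' ι) =
        pullback.snd (pullback.snd p s') (pullback.fst s' ι) ∧
      IsNeronModel (pullback.fst s' ι) (pullback.snd a (pullback.snd s' ι))
        (pullback.snd p s') r₂ := by
  subst hs'
  have hN := neronProp_of_isNeronModel ι a p r h
  obtain ⟨hsm, hsep, -, hqc, hr, hra, -⟩ := h
  have hsm : Smooth p := hsm
  set k := S.fromSpecStalk s with hk
  -- the comparison morphism `N ×_S Ũ ⟶ N ×_S U`
  let φ₀ : pullback (pullback.snd p k) (pullback.fst k ι) ⟶ pullback p ι :=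
    pullback.lift (pullback.fst _ _ ≫ pullback.fst p k) (pullback.snd _ _ ≫ pullback.snd k ι) (by
      rw [Category.assoc, pullback.condition, pullback.condition_assoc, Category.assoc,
        pullback.condition])
  have hφ1 : φ₀ ≫ pullback.fst p ι = pullback.fst _ _ ≫ pullback.fst p k := pullback.lift_fst _ _ _
  have hφ2 : φ₀ ≫ pullback.snd p ι = pullback.snd _ _ ≫ pullback.snd k ι := pullback.lift_snd _ _ _
  have hφ : IsPullback φ₀ (pullback.snd (pullback.snd p k) (pullback.fst k ι)) (pullback.snd p ι)
      (pullback.snd k ι) := by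
    apply IsPullback.of_right (h₁₂ := pullback.fst p ι) (h₂₂ := ι) (v₁₃ := p)
    · rw [hφ1, ← pullback.condition (f := k) (g := ι)]
      exact (IsPullback.of_hasPullback (pullback.snd p k) (pullback.fst k ι)).paste_horiz
        (IsPullback.of_hasPullback p k)
    · exact hφ2
    · exact IsPullback.of_hasPullback p ι
  have hpb : IsPullback (φ₀ ≫ r) (pullback.snd (pullback.snd p k) (pullback.fst k ι)) a
      (pullback.snd k ι) := by
    refine hφ.of_iso (Iso.refl _) (asIso r) (Iso.refl _) (Iso.refl _) ?_ ?_ ?_ ?_ <;> simp [hra]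
  refine ⟨hpb.isoPullback.hom, ?_, hpb.isoPullback_hom_snd, ?_⟩
  · intro φ h1 h2
    have : φ = φ₀ := by
      apply pullback.hom_ext
      · rw [h1, hφ1]
      · rw [h2, hφ2]
    rw [this, hpb.isoPullback_hom_fst]
  · exact isNeronModel_of_neronProp _ _ _ _ inferInstance inferInstance inferInstance
      inferInstance hpb.isoPullback_hom_snd (neronProp_stalk s ι p hN)
end

section
/- Let f : (A, 𝔪) → (B, 𝔫) be a flat local homomorphism of noetherian local rings. If A is a regular local ring and the fibre ring B/𝔪B is a regular local ring, then B is a regular local ring. -/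
/-- A commutative ring is a regular local ring if it is a noetherian local ring whose
maximal ideal is generated by `dim R` elements. -/
def IsRegularLocal (R : Type) [CommRing R] : Prop :=
  IsNoetherianRing R ∧ ∃ h : IsLocalRing R, ∃ s : Finset R,
    Ideal.span (s : Set R) = @IsLocalRing.maximalIdeal R _ h ∧
      (s.card : WithBot (WithTop ℕ)) = ringKrullDim R

/-- if `f : A → B` is a flat local homomorphism of noetherian local rings,
`A` is regular and the fibre ring `B/𝔪B` is regular, then `B` is regular. -/
theorem regular_of_flat_local_of_regular_fibre {A B : Type} [CommRing A] [CommRing B]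
    [IsLocalRing A] [IsLocalRing B] [IsNoetherianRing A] [IsNoetherianRing B]
    (f : A →+* B) [IsLocalHom f]
    (hflat : letI := f.toAlgebra; Module.Flat A B)
    (hA : IsRegularLocal A)
    (hfib : IsRegularLocal (B ⧸ (IsLocalRing.maximalIdeal A).map f)) :
    IsRegularLocal B := by
  classical
  letI := f.toAlgebra
  haveI : Module.Flat A B := hflat
  haveI : IsLocalHom (algebraMap A B) := ‹IsLocalHom f›
  obtain ⟨_, hlA, s, hs, hsc⟩ := hA
  obtain ⟨_, hlF, s', hs', hsc'⟩ := hfib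
  have hle : (IsLocalRing.maximalIdeal A).map f ≤ IsLocalRing.maximalIdeal B :=
    ((IsLocalRing.local_hom_TFAE f).out 0 2).mp ‹IsLocalHom f›
  have hcomap : (IsLocalRing.maximalIdeal (B ⧸ (IsLocalRing.maximalIdeal A).map f)).comap
      (Ideal.Quotient.mk _) = IsLocalRing.maximalIdeal B := by
    haveI := Ideal.comap_isMaximal_of_surjective
      (Ideal.Quotient.mk ((IsLocalRing.maximalIdeal A).map f)) Ideal.Quotient.mk_surjective
      (K := IsLocalRing.maximalIdeal (B ⧸ (IsLocalRing.maximalIdeal A).map f))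
    exact IsLocalRing.eq_maximalIdeal this
  have hmap : (IsLocalRing.maximalIdeal B).map
      (Ideal.Quotient.mk ((IsLocalRing.maximalIdeal A).map f)) =
      IsLocalRing.maximalIdeal (B ⧸ (IsLocalRing.maximalIdeal A).map f) := by
    rw [← hcomap, Ideal.map_comap_of_surjective _ Ideal.Quotient.mk_surjective]
  have hdim : ringKrullDim B = ringKrullDim A +
      ringKrullDim (B ⧸ (IsLocalRing.maximalIdeal A).map f) := by
    have h := Ideal.height_eq_height_add_of_liesOver_of_hasGoingDown
      (IsLocalRing.maximalIdeal A) (IsLocalRing.maximalIdeal B)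
    have h2 : (IsLocalRing.maximalIdeal B).height = (IsLocalRing.maximalIdeal A).height +
      (IsLocalRing.maximalIdeal (B ⧸ (IsLocalRing.maximalIdeal A).map f)).height := by
      rw [← hmap]
      exact h
    rw [← IsLocalRing.maximalIdeal_height_eq_ringKrullDim,
      ← IsLocalRing.maximalIdeal_height_eq_ringKrullDim,
      ← IsLocalRing.maximalIdeal_height_eq_ringKrullDim, h2, WithBot.coe_add]
  obtain ⟨o, -, hinj, himg⟩ := s'.exists_subset_injOn_image_eq_of_surjOn
    (f := Ideal.Quotient.mk ((IsLocalRing.maximalIdeal A).map f)) Set.univ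
    (fun x _ => by
      obtain ⟨y, rfl⟩ := Ideal.Quotient.mk_surjective x
      exact ⟨y, trivial, rfl⟩)
  have hocard : o.card = s'.card := by
    rw [← himg, Finset.card_image_of_injOn hinj]
  have hspan : Ideal.span ((s.image f ∪ o : Finset B) : Set B) =
      IsLocalRing.maximalIdeal B := by
    rw [Finset.coe_union, Finset.coe_image, Ideal.span_union, ← Ideal.map_span, hs, ← hcomap,
      ← hs', ← himg, Finset.coe_image, ← Ideal.map_span,
      Ideal.comap_map_of_surjective _ Ideal.Quotient.mk_surjective, ← RingHom.ker_eq_comap_bot,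
      Ideal.mk_ker, sup_comm]
  have hcard : (s.image f ∪ o).card ≤ s.card + s'.card :=
    (Finset.card_union_le _ _).trans (add_le_add Finset.card_image_le hocard.le)
  refine ⟨inferInstance, inferInstance, s.image f ∪ o, hspan, le_antisymm ?_ ?_⟩
  · rw [hdim, ← hsc, ← hsc']
    have h : (((s.image f ∪ o).card : ℕ) : WithBot ℕ∞) ≤
        ((s.card : ℕ) : WithBot ℕ∞) + ((s'.card : ℕ) : WithBot ℕ∞) := by
      exact_mod_cast hcard
    exact h
  · refine (ringKrullDim_le_spanFinrank_maximalIdeal B).trans ?_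
    have h := Submodule.spanFinrank_span_le_ncard_of_finite (R := B)
      (s.image f ∪ o).finite_toSet
    rw [Set.ncard_coe_finset] at h
    have h' : (IsLocalRing.maximalIdeal B).spanFinrank ≤ (s.image f ∪ o).card := by
      rw [← hspan]
      exact h
    have h2 : (((IsLocalRing.maximalIdeal B).spanFinrank : ℕ) : WithBot ℕ∞) ≤
        (((s.image f ∪ o).card : ℕ) : WithBot ℕ∞) := by
      exact_mod_cast h'
    exact h2
end

section
/- Let f : (R, 𝔪) → (R', 𝔪') be a flat local homomorphism of local rings and let I be a finitely generated ideal of R such that the extension ideal I·R' is principal. Then I is a principal ideal of R. -/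
/-- if `f : R → R'` is a flat local homomorphism of local rings and `I` is a
finitely generated ideal of `R` whose extension `I·R'` is principal, then `I` is principal. -/
theorem isPrincipal_of_flat_local_map {R R' : Type} [CommRing R] [CommRing R']
    [IsLocalRing R] [IsLocalRing R'] (f : R →+* R') [IsLocalHom f]
    (hflat : letI := f.toAlgebra; Module.Flat R R')
    (I : Ideal R) (hfg : I.FG) (hprin : (I.map f).IsPrincipal) :
    I.IsPrincipal := by
  letI := f.toAlgebra
  haveI : Module.Flat R R' := hflat
  haveI : IsLocalHom (algebraMap R R') := ‹IsLocalHom f›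
  haveI : Module.FaithfullyFlat R R' := Module.FaithfullyFlat.of_flat_of_isLocalHom
  have key : ∃ a ∈ I, I.map f = Ideal.span {f a} := by
    obtain ⟨g, hg⟩ := hprin
    change I.map f = Ideal.span {g} at hg
    by_contra! hno
    have hle : I.map f ≤ IsLocalRing.maximalIdeal R' * I.map f := by
      refine Ideal.map_le_iff_le_comap.2 fun a ha => ?_
      have h1 : f a ∈ Ideal.span {g} := hg ▸ Ideal.mem_map_of_mem f ha
      obtain ⟨s, hs⟩ := Ideal.mem_span_singleton'.1 h1
      have hgJ : g ∈ I.map f := hg ▸ Ideal.mem_span_singleton_self g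
      rw [Ideal.mem_comap, ← hs]
      refine Ideal.mul_mem_mul ?_ hgJ
      rw [IsLocalRing.mem_maximalIdeal, mem_nonunits_iff]
      intro hu
      apply hno a ha
      rw [← hs, hg, Ideal.span_singleton_mul_left_unit hu]
    have hbot : I.map f = ⊥ :=
      Submodule.eq_bot_of_le_smul_of_le_jacobson_bot _ _ (hfg.map f) hle
        (IsLocalRing.maximalIdeal_le_jacobson _)
    apply hno 0 I.zero_mem
    simp [hbot]
  obtain ⟨a, ha, h⟩ := key
  refine ⟨a, ?_⟩
  change I = Ideal.span {a}
  rw [← Ideal.comap_map_eq_self_of_faithfullyFlat (B := R') I,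
    ← Ideal.comap_map_eq_self_of_faithfullyFlat (B := R') (Ideal.span {a})]
  congr 1
  rw [Ideal.map_span, Set.image_singleton]
  exact h
end
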